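/- arXiv:2210.02751 — 10 statements merged into one kernel-verified Lean document; each statement's English description precedes it below -/
import Mathlib

section
/- There exists a unique function h : ℝ → ℝ such that h(0) = 0 and, for every s ∈ ℝ, h is differentiable at s with derivative h'(s) = (1 + 2·(h s)²)^(−1/2); moreover, this function is odd, i.e. h(−s) = −h(s) for all s ∈ ℝ. -/
open Filter Topology in
theorem aux_G : ∃ G : ℝ → ℝ, G 0 = 0 ∧ (∀ t, HasDerivAt G ((1 + 2 * t ^ 2) ^ (1 / 2 : ℝ)) t) ∧
    StrictMono G ∧ Function.Surjective G := by
  have hc : Continuous (fun t : ℝ => (1 + 2 * t ^ 2) ^ (1 / 2 : ℝ)) := by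
    apply Continuous.rpow_const (by fun_prop)
    intro x; right; norm_num
  have hd : ∀ t, HasDerivAt (fun t : ℝ => ∫ x in (0:ℝ)..t, (1 + 2 * x ^ 2) ^ (1 / 2 : ℝ))
      ((1 + 2 * t ^ 2) ^ (1 / 2 : ℝ)) t := fun t => hc.integral_hasStrictDerivAt 0 t |>.hasDerivAt
  have h0 : (fun t : ℝ => ∫ x in (0:ℝ)..t, (1 + 2 * x ^ 2) ^ (1 / 2 : ℝ)) 0 = 0 := by simp
  generalize (fun t : ℝ => ∫ x in (0:ℝ)..t, (1 + 2 * x ^ 2) ^ (1 / 2 : ℝ)) = G at hd h0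
  have hm : Monotone (fun t => G t - t) := by
    apply monotone_of_hasDerivAt_nonneg (fun t => (hd t).sub (hasDerivAt_id t))
    intro t
    have : (1:ℝ) ≤ (1 + 2 * t ^ 2) ^ (1 / 2 : ℝ) :=
      Real.one_le_rpow (by nlinarith [sq_nonneg t]) (by norm_num)
    simpa using this
  have hcG : Continuous G := continuous_iff_continuousAt.2 fun t => (hd t).continuousAt
  refine ⟨G, h0, hd, ?_, ?_⟩
  · intro a b hab
    have := hm hab.le
    simp only at this
    linarith
  · apply hcG.surjective
    · apply tendsto_atTop_mono' _ _ tendsto_id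
      filter_upwards [eventually_ge_atTop 0] with t ht
      have := hm ht
      simp only [h0, id] at this ⊢
      linarith
    · apply tendsto_atBot_mono' _ _ tendsto_id
      filter_upwards [eventually_le_atBot 0] with t ht
      have := hm ht
      simp only [h0, id] at this ⊢
      linarith

theorem aux_inv {G h : ℝ → ℝ} (G0 : G 0 = 0)
    (hd : ∀ t, HasDerivAt G ((1 + 2 * t ^ 2) ^ (1 / 2 : ℝ)) t)
    (hh : h 0 = 0 ∧ ∀ s : ℝ, HasDerivAt h ((1 + 2 * (h s) ^ 2) ^ (-(1 / 2) : ℝ)) s) (s : ℝ) :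
    G (h s) = s := by
  have key : ∀ s, HasDerivAt (fun s => G (h s) - s) 0 s := by
    intro s
    have h1 := ((hd (h s)).comp s (hh.2 s)).sub (hasDerivAt_id s)
    have hp : (0:ℝ) < 1 + 2 * (h s) ^ 2 := by positivity
    rw [← Real.rpow_add hp] at h1
    refine HasDerivAt.congr_deriv (f := fun s => G (h s) - s) h1 ?_
    simp
  have := is_const_of_deriv_eq_zero (fun s => (key s).differentiableAt) (fun s => (key s).deriv) s 0
  simp only [hh.1, G0] at this
  linarith

/-- Existence and uniqueness of the change-of-variables function `h` with
`h 0 = 0` and `h' s = (1 + 2 (h s)^2)^(-1/2)`, together with its oddness. -/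
theorem stmt_0 :
    (∃! h : ℝ → ℝ, h 0 = 0 ∧
      ∀ s : ℝ, HasDerivAt h ((1 + 2 * (h s) ^ 2) ^ (-(1 / 2) : ℝ)) s) ∧
    (∀ h : ℝ → ℝ,
      (h 0 = 0 ∧ ∀ s : ℝ, HasDerivAt h ((1 + 2 * (h s) ^ 2) ^ (-(1 / 2) : ℝ)) s) →
      ∀ s : ℝ, h (-s) = - h s) := by
  obtain ⟨G, G0, hd, hsm, hsur⟩ := aux_G
  refine ⟨?_, ?_⟩
  · let e := hsm.orderIsoOfSurjective G hsur
    have he : ∀ y, G (e.symm y) = y := fun y => e.apply_symm_apply y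
    refine ⟨e.symm, ⟨hsm.injective (by rw [he, G0]), ?_⟩, ?_⟩
    · intro s
      have hp : (0:ℝ) < 1 + 2 * (e.symm s) ^ 2 := by positivity
      rw [Real.rpow_neg hp.le]
      exact HasDerivAt.of_local_left_inverse e.symm.continuous.continuousAt (hd _)
        (Real.rpow_pos_of_pos hp _).ne' (Filter.Eventually.of_forall he)
    · intro k hk
      funext s
      apply hsm.injective
      rw [he, aux_inv G0 hd hk]
  · intro h hh s
    have hk : (fun s => - h (-s)) 0 = 0 ∧ ∀ s : ℝ, HasDerivAt (fun s => - h (-s))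
        ((1 + 2 * ((fun s => - h (-s)) s) ^ 2) ^ (-(1 / 2) : ℝ)) s := by
      refine ⟨by simp [hh.1], fun s => ?_⟩
      have := ((hh.2 (-s)).comp s (hasDerivAt_neg s)).neg
      refine HasDerivAt.congr_deriv (f := fun s => - h (-s)) this ?_
      simp
    have h1 := aux_inv (h := fun s => - h (-s)) G0 hd hk s
    have h2 := aux_inv G0 hd hh s
    have := hsm.injective (h1.trans h2.symm)
    linarith
end

section
/- For every s > 0 one has (1/2)·h(s) ≤ s·h'(s) ≤ h(s), where h'(s) = (1 + 2·(h s)²)^(−1/2). -/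
/-- `(1/2) h(s) ≤ s h'(s) ≤ h(s)` for all `s > 0`. -/
theorem stmt_3 (h : ℝ → ℝ) (h0 : h 0 = 0)
    (hDeriv : ∀ s : ℝ, HasDerivAt h ((1 + 2 * (h s) ^ 2) ^ (-(1 / 2) : ℝ)) s) :
    ∀ s : ℝ, 0 < s →
      (1 / 2) * h s ≤ s * ((1 + 2 * (h s) ^ 2) ^ (-(1 / 2) : ℝ)) ∧
      s * ((1 + 2 * (h s) ^ 2) ^ (-(1 / 2) : ℝ)) ≤ h s := by
  have e : ∀ s, (1 + 2 * (h s) ^ 2) ^ (-(1 / 2) : ℝ) = (Real.sqrt (1 + 2 * (h s) ^ 2))⁻¹ := by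
    intro s
    rw [Real.rpow_neg (by positivity), Real.sqrt_eq_rpow]
  simp only [e] at hDeriv ⊢
  have g : ∀ s, HasDerivAt (fun s => h s * Real.sqrt (1 + 2 * (h s) ^ 2))
      (1 + 2 * (h s) ^ 2 / (1 + 2 * (h s) ^ 2)) s := by
    intro s
    have hp : 0 < 1 + 2 * (h s) ^ 2 := by positivity
    have hw : 0 < Real.sqrt (1 + 2 * (h s) ^ 2) := Real.sqrt_pos.2 hp
    have hq := Real.sq_sqrt hp.le
    have k := (hDeriv s).mul (((((hDeriv s).pow 2).const_mul 2).const_add 1).sqrt hp.ne')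
    refine k.congr_deriv ?_
    simp only [Pi.pow_apply]
    rw [inv_mul_cancel₀ hw.ne']
    congr 1
    generalize Real.sqrt (1 + 2 * (h s) ^ 2) = w at *
    rw [← hq]
    field_simp
    norm_num
    ring
  have m1 : Monotone (fun s => h s * Real.sqrt (1 + 2 * (h s) ^ 2) - s) := by
    refine monotone_of_hasDerivAt_nonneg (fun s => (g s).sub (hasDerivAt_id s)) fun s => ?_
    have : 0 ≤ 2 * (h s) ^ 2 / (1 + 2 * (h s) ^ 2) := by positivity
    simpa using this
  have m2 : Monotone (fun s => 2 * s - h s * Real.sqrt (1 + 2 * (h s) ^ 2)) := by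
    refine monotone_of_hasDerivAt_nonneg
      (fun s => ((hasDerivAt_id s).const_mul 2).sub (g s)) fun s => ?_
    have : 2 * (h s) ^ 2 / (1 + 2 * (h s) ^ 2) ≤ 1 := by
      rw [div_le_one (by positivity)]
      linarith
    simp only [Pi.zero_apply]
    linarith
  intro s hs
  have a := m1 hs.le
  have b := m2 hs.le
  simp only [h0] at a b
  have hw : 0 < Real.sqrt (1 + 2 * (h s) ^ 2) := Real.sqrt_pos.2 (by positivity)
  rw [← div_eq_mul_inv, le_div_iff₀ hw, div_le_iff₀ hw]
  constructor <;> linarith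
end

section
/- For every s ∈ ℝ one has |h(s)| ≤ 2^(1/4)·|s|^(1/2). -/
/-- `|h s| ≤ 2^(1/4) |s|^(1/2)` for all real `s`. -/
theorem stmt_4 (h : ℝ → ℝ) (h0 : h 0 = 0)
    (hDeriv : ∀ s : ℝ, HasDerivAt h ((1 + 2 * (h s) ^ 2) ^ (-(1 / 2) : ℝ)) s) :
    ∀ s : ℝ, |h s| ≤ (2 : ℝ) ^ ((1 / 4 : ℝ)) * |s| ^ ((1 / 2 : ℝ)) := by
  intro s
  have key : ‖h s ^ 2 - h 0 ^ 2‖ ≤ √2 * ‖s - 0‖ := by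
    refine Convex.norm_image_sub_le_of_norm_hasDerivWithin_le (s := Set.univ)
      (f := fun x => h x ^ 2)
      (f' := fun x => ((2 : ℕ) : ℝ) * h x ^ (2 - 1) * ((1 + 2 * (h x) ^ 2) ^ (-(1 / 2) : ℝ)))
      (fun x _ => ((hDeriv x).pow 2).hasDerivWithinAt) ?_ convex_univ
      (Set.mem_univ 0) (Set.mem_univ s)
    intro x _
    have hp : (0 : ℝ) < 1 + 2 * h x ^ 2 := by positivity
    rw [Real.rpow_neg hp.le, ← Real.sqrt_eq_rpow, Real.norm_eq_abs, ← div_eq_mul_inv, abs_div,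
      abs_of_nonneg (Real.sqrt_nonneg (1 + 2 * h x ^ 2)), div_le_iff₀ (Real.sqrt_pos.mpr hp),
      ← Real.sqrt_mul (by norm_num)]
    apply Real.le_sqrt_of_sq_le
    rw [sq_abs]
    push_cast
    nlinarith
  rw [h0, Real.norm_eq_abs, Real.norm_eq_abs] at key
  have k2 : h s ^ 2 ≤ √2 * |s| := by
    have := le_abs_self (h s ^ 2 - 0 ^ 2)
    simp only [sub_zero] at key
    norm_num at key ⊢
    exact key
  apply abs_le_of_sq_le_sq _ (by positivity)
  rw [mul_pow, ← Real.rpow_natCast, ← Real.rpow_natCast (|s| ^ (1 / 2 : ℝ)),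
    ← Real.rpow_natCast, ← Real.rpow_mul (by norm_num), ← Real.rpow_mul (abs_nonneg s)]
  rw [Real.sqrt_eq_rpow] at k2
  norm_num at k2 ⊢
  exact k2
end

section
/- The limit lim_{s → +∞} h(s)/s^(1/2) = 2^(1/4) holds, i.e. the function s ↦ h(s)/√s tends to 2^(1/4) as s → +∞. -/
/-- `h(s)/√s → 2^(1/4)` as `s → +∞`. -/
theorem stmt_5 (h : ℝ → ℝ) (h0 : h 0 = 0)
    (hDeriv : ∀ s : ℝ, HasDerivAt h ((1 + 2 * (h s) ^ 2) ^ (-(1 / 2) : ℝ)) s) :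
    Filter.Tendsto (fun s : ℝ => h s / Real.sqrt s) Filter.atTop
      (nhds ((2 : ℝ) ^ ((1 / 4 : ℝ)))) := by
  have hD : ∀ s : ℝ, HasDerivAt h ((Real.sqrt (1 + 2 * (h s) ^ 2))⁻¹) s := by
    intro s
    have := hDeriv s
    rwa [Real.rpow_neg (by positivity), ← Real.sqrt_eq_rpow] at this
  have hmono : Monotone h := by
    apply monotone_of_deriv_nonneg (fun s => (hD s).differentiableAt)
    intro s
    rw [(hD s).deriv]
    positivity
  have hpos : ∀ s, 0 ≤ s → 0 ≤ h s := fun s hs => h0 ▸ hmono hs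
  have h2 : (0:ℝ) < √2 := by positivity
  have h22 : √2 * √2 = (2:ℝ) := Real.mul_self_sqrt (by norm_num)
  have hd1 : ∀ s, HasDerivAt (fun s => √2 * s - h s ^ 2)
      (√2 - 2 * h s * (Real.sqrt (1 + 2 * (h s) ^ 2))⁻¹) s := by
    intro s
    have := ((hasDerivAt_id s).const_mul (√2)).sub ((hD s).pow 2)
    refine this.congr_deriv ?_
    simp
  have hd2 : ∀ s, HasDerivAt (fun s => √2 * h s + h s ^ 2 - √2 * s)
      (√2 * (Real.sqrt (1 + 2 * (h s) ^ 2))⁻¹ +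
        2 * h s * (Real.sqrt (1 + 2 * (h s) ^ 2))⁻¹ - √2) s := by
    intro s
    have := (((hD s).const_mul (√2)).add ((hD s).pow 2)).sub
      ((hasDerivAt_id s).const_mul (√2))
    refine this.congr_deriv ?_
    simp
  have up : ∀ s, 0 ≤ s → h s ^ 2 ≤ √2 * s := by
    have hm : Monotone (fun s => √2 * s - h s ^ 2) := by
      apply monotone_of_deriv_nonneg (fun s => (hd1 s).differentiableAt)
      intro s
      rw [(hd1 s).deriv, sub_nonneg, ← div_eq_mul_inv, div_le_iff₀ (by positivity),
        ← Real.sqrt_mul (by norm_num)]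
      apply Real.le_sqrt_of_sq_le
      nlinarith
    intro s hs
    have := hm hs
    simp [h0] at this
    exact this
  have lo : ∀ s, 0 ≤ s → √2 * s ≤ √2 * h s + h s ^ 2 := by
    have hm : MonotoneOn (fun s => √2 * h s + h s ^ 2 - √2 * s) (Set.Ici 0) := by
      apply monotoneOn_of_deriv_nonneg (convex_Ici 0)
        (fun s _ => (hd2 s).continuousAt.continuousWithinAt)
        (fun s _ => (hd2 s).differentiableAt.differentiableWithinAt)
      intro s hs
      rw [interior_Ici] at hs
      have hp := hpos s (le_of_lt hs)
      rw [(hd2 s).deriv, sub_nonneg, ← add_mul, ← div_eq_mul_inv, le_div_iff₀ (by positivity),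
        ← Real.sqrt_mul (by norm_num)]
      apply Real.sqrt_le_iff.2
      constructor
      · positivity
      · nlinarith [mul_nonneg h2.le hp]
    intro s hs
    have := hm (Set.mem_Ici.2 le_rfl) (Set.mem_Ici.2 hs) hs
    simp [h0] at this
    exact this
  have s2 : √2 ≤ (2:ℝ) := by nlinarith
  have key : Filter.Tendsto (fun s => h s ^ 2 / s) Filter.atTop (nhds (√2)) := by
    have hlow : Filter.Tendsto (fun s : ℝ => √2 - 4 * (√s)⁻¹) Filter.atTop (nhds (√2)) := by
      have := ((tendsto_inv_atTop_zero.comp Real.tendsto_sqrt_atTop).const_mul (4:ℝ)).const_sub (√2)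
      simpa using this
    refine tendsto_of_tendsto_of_tendsto_of_le_of_le' hlow tendsto_const_nhds ?_ ?_
    · filter_upwards [Filter.eventually_gt_atTop 0] with s hs
      have hq : 0 < √s := Real.sqrt_pos.2 hs
      have hqq : √s * √s = s := Real.mul_self_sqrt hs.le
      have hp := hpos s hs.le
      have hb : h s ≤ 2 * √s := by
        refine abs_le_of_sq_le_sq' ?_ (by positivity) |>.2
        nlinarith [up s hs.le]
      rw [le_div_iff₀ hs]
      have : (√2 - 4 * (√s)⁻¹) * s = √2 * s - 4 * √s := by
        nth_rw 2 [← hqq]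
        nth_rw 4 [← hqq]
        field_simp
      nlinarith [lo s hs.le]
    · filter_upwards [Filter.eventually_gt_atTop 0] with s hs
      rw [div_le_iff₀ hs]
      exact up s hs.le
  have e : (2 : ℝ) ^ ((1 / 4 : ℝ)) = √(√2) := by
    rw [Real.sqrt_eq_rpow, Real.sqrt_eq_rpow, ← Real.rpow_mul (by norm_num)]
    norm_num
  rw [e]
  refine ((Real.continuous_sqrt.tendsto _).comp key).congr' ?_
  filter_upwards [Filter.eventually_gt_atTop 0] with s hs
  simp only [Function.comp]
  rw [Real.sqrt_div (by positivity), Real.sqrt_sq (hpos s hs.le)]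
end

section
/- For every s ∈ ℝ with |s| ≤ 1 one has |h(s)| ≥ h(1)·|s|, and for every s ∈ ℝ with |s| ≥ 1 one has |h(s)| ≥ h(1)·|s|^(1/2). -/
lemma ode_unique (h g : ℝ → ℝ) (h0 : h 0 = 0) (g0 : g 0 = 0)
    (hd : ∀ s, HasDerivAt h (√(1 + 2 * (h s) ^ 2))⁻¹ s)
    (gd : ∀ s, HasDerivAt g (√(1 + 2 * (g s) ^ 2))⁻¹ s) (s : ℝ) : h s = g s := by
  have hc : Continuous (fun t : ℝ => √(1 + 2 * t ^ 2)) := by fun_prop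
  have hG : ∀ t, HasDerivAt (fun t => ∫ x in (0:ℝ)..t, √(1 + 2 * x ^ 2)) (√(1 + 2 * t ^ 2)) t :=
    fun t => hc.integral_hasStrictDerivAt 0 t |>.hasDerivAt
  set G : ℝ → ℝ := fun t => ∫ x in (0:ℝ)..t, √(1 + 2 * x ^ 2) with hGdef
  have pos : ∀ t : ℝ, 0 < √(1 + 2 * t ^ 2) := fun t => by positivity
  have hmono : StrictMono G := strictMono_of_deriv_pos (fun t => by rw [(hG t).deriv]; exact pos t)
  have key : ∀ f : ℝ → ℝ, f 0 = 0 → (∀ s, HasDerivAt f (√(1 + 2 * (f s) ^ 2))⁻¹ s) →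
      ∀ s, G (f s) - s = G 0 := by
    intro f f0 fd s
    have hd' : ∀ x, HasDerivAt (fun x => G (f x) - x) 0 x := by
      intro x
      have := ((hG (f x)).comp x (fd x)).sub (hasDerivAt_id x)
      rw [mul_inv_cancel₀ (pos _).ne', sub_self] at this
      exact this
    have := is_const_of_deriv_eq_zero (fun x => (hd' x).differentiableAt)
      (fun x => (hd' x).deriv) s 0
    simpa [f0] using this
  apply hmono.injective
  linarith [key h h0 hd s, key g g0 gd s]

lemma pos_case (h : ℝ → ℝ) (h0 : h 0 = 0)
    (hd : ∀ s, HasDerivAt h (√(1 + 2 * (h s) ^ 2))⁻¹ s) :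
    (∀ s, 0 ≤ s → 0 ≤ h s) ∧ (∀ s, 0 ≤ s → s ≤ 1 → h 1 * s ≤ h s) ∧
    (∀ s, 1 ≤ s → h 1 * √s ≤ h s) := by
  have pos : ∀ t : ℝ, 0 < √(1 + 2 * t ^ 2) := fun t => by positivity
  have hmono : StrictMono h :=
    strictMono_of_deriv_pos (fun t => by rw [(hd t).deriv]; exact inv_pos.2 (pos _))
  have hnn : ∀ s, 0 ≤ s → 0 ≤ h s := fun s hs => h0 ▸ hmono.monotone hs
  have hcont : Continuous h := continuous_iff_continuousAt.2 fun s => (hd s).continuousAt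
  refine ⟨hnn, ?_, ?_⟩
  · intro s hs hs1
    have hconc : ConcaveOn ℝ (Set.Ici 0) h := by
      apply AntitoneOn.concaveOn_of_deriv (convex_Ici 0) hcont.continuousOn
        (fun x _ => (hd x).differentiableAt.differentiableWithinAt)
      intro x hx y hy hxy
      rw [interior_Ici] at hx
      rw [(hd x).deriv, (hd y).deriv]
      have h1 := hnn x (le_of_lt hx)
      have h2 := hmono.monotone hxy
      have := pos (h x)
      gcongr
    have := hconc.2 (x := 1) (y := 0) (by simp) (by simp) hs (sub_nonneg.2 hs1) (by ring)
    simp [h0] at this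
    linarith
  · intro s hs
    have hphi : ∀ x, HasDerivAt (fun x => 2 * x - h x * √(1 + 2 * (h x) ^ 2))
        ((√(1 + 2 * (h x) ^ 2))⁻¹ ^ 2) x := by
      intro x
      have hq : HasDerivAt (fun x => 1 + 2 * (h x) ^ 2)
          (2 * (2 * h x * (√(1 + 2 * (h x) ^ 2))⁻¹)) x := by
        have := (((hd x).pow 2).const_mul 2).const_add 1
        simpa using this
      have h1 := ((hasDerivAt_id x).const_mul 2).sub ((hd x).mul (hq.sqrt (by positivity)))
      refine h1.congr_deriv ?_
      have hw := Real.sq_sqrt (show 0 ≤ 1 + 2 * (h x) ^ 2 by positivity)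
      have := (pos (h x)).ne'
      generalize √(1 + 2 * (h x) ^ 2) = w at *
      field_simp
      linarith
    have hphm : Monotone (fun x => 2 * x - h x * √(1 + 2 * (h x) ^ 2)) :=
      monotone_of_deriv_nonneg (fun x => (hphi x).differentiableAt)
        (fun x => by rw [(hphi x).deriv]; positivity)
    have hle : ∀ x, 0 ≤ x → h x * √(1 + 2 * (h x) ^ 2) ≤ 2 * x := by
      intro x hx
      have := hphm hx
      simp [h0] at this
      linarith
    have hq : ∀ x, 0 < x → HasDerivAt (fun x => (h x) ^ 2 / x)
        ((2 * h x * (√(1 + 2 * (h x) ^ 2))⁻¹ * x - (h x) ^ 2) / x ^ 2) x := by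
      intro x hx
      have := ((hd x).pow 2).div (hasDerivAt_id x) hx.ne'
      exact this.congr_deriv (by simp)
    have hm : MonotoneOn (fun x => (h x) ^ 2 / x) (Set.Ici 1) := by
      apply monotoneOn_of_deriv_nonneg (convex_Ici 1)
      · intro x hx
        exact (hq x (lt_of_lt_of_le one_pos hx)).continuousAt.continuousWithinAt
      · intro x hx
        rw [interior_Ici] at hx
        exact (hq x (lt_trans one_pos hx)).differentiableAt.differentiableWithinAt
      · intro x hx
        rw [interior_Ici] at hx
        have hx0 : 0 < x := lt_trans one_pos hx
        rw [(hq x hx0).deriv]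
        apply div_nonneg _ (by positivity)
        have h1 := hle x hx0.le
        have h2 := hnn x hx0.le
        have h3 : h x ≤ 2 * x * (√(1 + 2 * (h x) ^ 2))⁻¹ := by
          rw [← div_eq_mul_inv, le_div_iff₀ (pos _)]; exact h1
        nlinarith [mul_le_mul_of_nonneg_left h3 h2]
    have := hm (Set.mem_Ici.2 le_rfl) (Set.mem_Ici.2 hs) hs
    simp only [div_one] at this
    rw [le_div_iff₀ (by linarith)] at this
    apply le_trans (le_abs_self _) (abs_le_of_sq_le_sq _ (hnn s (by linarith)))
    rw [mul_pow, Real.sq_sqrt (by linarith)]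
    exact this

/-- `|h s| ≥ h(1)|s|` for `|s| ≤ 1` and `|h s| ≥ h(1)|s|^(1/2)` for `|s| ≥ 1`. -/
theorem stmt_6 (h : ℝ → ℝ) (h0 : h 0 = 0)
    (hDeriv : ∀ s : ℝ, HasDerivAt h ((1 + 2 * (h s) ^ 2) ^ (-(1 / 2) : ℝ)) s) :
    (∀ s : ℝ, |s| ≤ 1 → h 1 * |s| ≤ |h s|) ∧
    (∀ s : ℝ, 1 ≤ |s| → h 1 * |s| ^ ((1 / 2 : ℝ)) ≤ |h s|) := by
  have hd : ∀ s, HasDerivAt h (√(1 + 2 * (h s) ^ 2))⁻¹ s := by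
    intro s
    have := hDeriv s
    rwa [Real.rpow_neg (by positivity), ← Real.sqrt_eq_rpow] at this
  have hodd : ∀ s, h s = - h (-s) := by
    refine ode_unique h (fun s => - h (-s)) h0 (by simp [h0]) hd ?_
    intro s
    have := ((hd (-s)).comp s (hasDerivAt_neg s)).neg
    exact this.congr_deriv (by simp)
  obtain ⟨hn, h1, h2⟩ := pos_case h h0 hd
  have habs : ∀ s, |h s| = h |s| := by
    intro s
    rcases le_total 0 s with hs | hs
    · rw [abs_of_nonneg hs, abs_of_nonneg (hn s hs)]
    · rw [abs_of_nonpos hs, hodd s, abs_neg, abs_of_nonneg (hn _ (by linarith))]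
  refine ⟨fun s hs => ?_, fun s hs => ?_⟩
  · rw [habs]; exact h1 _ (abs_nonneg s) hs
  · rw [habs, ← Real.sqrt_eq_rpow]; exact h2 _ hs
end

section
/- For every real γ ≥ 3, the function s ↦ (h(s))^γ · h'(s) / s is strictly increasing on the interval (0, +∞), where h'(s) = (1 + 2·(h s)²)^(−1/2). -/
/-- For `γ ≥ 3` the function `s ↦ (h s)^γ h'(s) / s` is strictly increasing on `(0, ∞)`. -/
theorem stmt_8 (h : ℝ → ℝ) (h0 : h 0 = 0)
    (hDeriv : ∀ s : ℝ, HasDerivAt h ((1 + 2 * (h s) ^ 2) ^ (-(1 / 2) : ℝ)) s) :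
    ∀ γ : ℝ, 3 ≤ γ →
      StrictMonoOn
        (fun s : ℝ => (h s) ^ γ * ((1 + 2 * (h s) ^ 2) ^ (-(1 / 2) : ℝ)) / s)
        (Set.Ioi (0 : ℝ)) := by
  intro γ hγ
  have hw : ∀ s, 0 < 1 + 2 * (h s) ^ 2 := fun s => by positivity
  have hrp : ∀ s, (1 + 2 * (h s) ^ 2) ^ (-(1 / 2) : ℝ) = (Real.sqrt (1 + 2 * (h s) ^ 2))⁻¹ := by
    intro s
    rw [Real.rpow_neg (hw s).le, Real.sqrt_eq_rpow]
  simp only [hrp] at hDeriv ⊢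
  obtain ⟨r, hr⟩ : ∃ r : ℝ → ℝ, r = fun s => Real.sqrt (1 + 2 * (h s) ^ 2) := ⟨_, rfl⟩
  have hr' : ∀ s, Real.sqrt (1 + 2 * (h s) ^ 2) = r s := fun s => by rw [hr]
  have rpos : ∀ s, 0 < r s := fun s => by rw [← hr']; exact Real.sqrt_pos.2 (hw s)
  have rsq : ∀ s, r s ^ 2 = 1 + 2 * (h s) ^ 2 := fun s => by
    rw [← hr']; exact Real.sq_sqrt (hw s).le
  have rD : ∀ s, HasDerivAt r (2 * h s / r s ^ 2) s := by
    intro s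
    have := ((((hDeriv s).pow 2).const_mul 2).const_add 1).sqrt (hw s).ne'
    simp only [Pi.pow_apply, hr'] at this
    refine this.congr_deriv ?_
    have := (rpos s).ne'
    simp
    field_simp
  simp only [hr'] at hDeriv ⊢
  have hmono : StrictMono h := by
    apply strictMono_of_deriv_pos
    intro s
    rw [(hDeriv s).deriv]
    exact inv_pos.2 (rpos s)
  have hpos : ∀ s, 0 < s → 0 < h s := fun s hs => by
    have := hmono hs
    rwa [h0] at this
  have phi : StrictMono (fun s => 2 * s - h s * r s) := by
    apply strictMono_of_deriv_pos
    intro s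
    have h1 : HasDerivAt (fun s => 2 * s - h s * r s) _ s :=
      ((hasDerivAt_id' s).const_mul 2).sub ((hDeriv s).mul (rD s))
    rw [h1.deriv]
    have h2 := (rpos s).ne'
    have h3 : 2 * 1 - ((r s)⁻¹ * r s + h s * (2 * h s / r s ^ 2)) = 1 / r s ^ 2 := by
      field_simp
      rw [rsq]; ring
    rw [h3]
    have := rpos s
    positivity
  have key : ∀ s, 0 < s → h s * r s < 2 * s := fun s hs => by
    have := phi hs
    simp only [h0] at this
    linarith
  have gD : ∀ s, 0 < s → HasDerivAt (fun s => h s ^ 3 / (s * r s))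
      ((h s ^ 2 * (s * (3 + 4 * h s ^ 2) - h s * r s * r s ^ 2)) / r s ^ 2 / (s * r s) ^ 2) s := by
    intro s hs
    have h2 := (rpos s).ne'
    have h1 := ((hDeriv s).pow 3).div ((hasDerivAt_id' s).mul (rD s)) (mul_ne_zero hs.ne' h2)
    refine h1.congr_deriv ?_
    have e : 3 + 4 * h s ^ 2 = 3 * r s ^ 2 - 2 * h s ^ 2 := by rw [rsq]; ring
    rw [e]
    simp
    field_simp
    try ring
  have gmono : StrictMonoOn (fun s => h s ^ 3 / (s * r s)) (Set.Ioi 0) := by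
    apply strictMonoOn_of_deriv_pos (convex_Ioi 0)
    · intro s hs
      exact (gD s hs).continuousAt.continuousWithinAt
    · intro s hs
      rw [interior_Ioi] at hs
      have hs : 0 < s := hs
      rw [(gD s hs).deriv]
      have h1 := hpos s hs
      have h2 := rpos s
      have h3 := key s hs
      have : 0 < s * (3 + 4 * h s ^ 2) - h s * r s * r s ^ 2 := by
        rw [rsq]
        nlinarith [mul_lt_mul_of_pos_right h3 (hw s)]
      positivity
  intro a ha b hb hab
  have ha' : 0 < a := ha
  have hb' : 0 < b := hb
  have e : ∀ s, 0 < s → h s ^ γ * (r s)⁻¹ / s = h s ^ (γ - 3) * (h s ^ 3 / (s * r s)) := by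
    intro s hs
    have : h s ^ γ = h s ^ (γ - 3) * h s ^ 3 := by
      rw [← Real.rpow_natCast, ← Real.rpow_add (hpos s hs)]
      norm_num
    rw [this]
    have := (rpos s).ne'
    field_simp
  simp only [e a ha', e b hb']
  have h1 : h a ^ (γ - 3) ≤ h b ^ (γ - 3) :=
    Real.rpow_le_rpow (hpos a ha').le (hmono hab).le (by linarith)
  have h2 := gmono ha hb hab
  have h3 : 0 < h a ^ 3 / (a * r a) := by
    have := hpos a ha'
    have := rpos a
    positivity
  exact mul_lt_mul' h1 h2 h3.le (Real.rpow_pos_of_pos (hpos b hb') _)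
end

section
/- Let φ : ℝ → ℝ be a function with φ(t) ≥ 0 for every t > 0 and such that t ↦ φ(t)/t³ is monotone nondecreasing on (0, +∞). Then the function s ↦ φ(h(s)) · h'(s) is monotone nondecreasing on (0, +∞), where h'(s) = (1 + 2·(h s)²)^(−1/2). -/
/-- If `φ ≥ 0` on `(0,∞)` and `t ↦ φ(t)/t³` is nondecreasing on `(0,∞)`, then
`s ↦ φ(h s) h'(s)` is nondecreasing on `(0,∞)`. -/
theorem stmt_12 (h : ℝ → ℝ) (h0 : h 0 = 0)
    (hDeriv : ∀ s : ℝ, HasDerivAt h ((1 + 2 * (h s) ^ 2) ^ (-(1 / 2) : ℝ)) s)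
    (φ : ℝ → ℝ) (hφ0 : ∀ t : ℝ, 0 < t → 0 ≤ φ t)
    (hφmono : MonotoneOn (fun t : ℝ => φ t / t ^ 3) (Set.Ioi (0 : ℝ))) :
    MonotoneOn (fun s : ℝ => φ (h s) * ((1 + 2 * (h s) ^ 2) ^ (-(1 / 2) : ℝ)))
      (Set.Ioi (0 : ℝ)) := by
  have hsm : StrictMono h := strictMono_of_deriv_pos (fun x => by
    rw [(hDeriv x).deriv]; positivity)
  have key : ∀ x : ℝ, (1 + 2 * x ^ 2) ^ (-(1 / 2) : ℝ) = (√(1 + 2 * x ^ 2))⁻¹ := fun x => by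
    rw [Real.rpow_neg (by positivity), Real.sqrt_eq_rpow]
  intro s hs t ht hst
  have ha : 0 < h s := by rw [← h0]; exact hsm hs
  have hab : h s ≤ h t := hsm.monotone hst
  simp only [key]
  generalize h s = a at *
  generalize h t = b at *
  have hb : 0 < b := lt_of_lt_of_le ha hab
  have h1 : φ a / a ^ 3 ≤ φ b / b ^ 3 := hφmono ha hb hab
  have hA : 0 < √(1 + 2 * a ^ 2) := Real.sqrt_pos.2 (by positivity)
  have hB : 0 < √(1 + 2 * b ^ 2) := Real.sqrt_pos.2 (by positivity)
  have h2 : a * √(1 + 2 * b ^ 2) ≤ b * √(1 + 2 * a ^ 2) := by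
    refine (pow_le_pow_iff_left₀ (by positivity) (by positivity) two_ne_zero).1 ?_
    rw [mul_pow, mul_pow, Real.sq_sqrt (by positivity), Real.sq_sqrt (by positivity)]
    nlinarith [pow_le_pow_left₀ ha.le hab 2]
  have h3 : a ^ 3 * (√(1 + 2 * a ^ 2))⁻¹ ≤ b ^ 3 * (√(1 + 2 * b ^ 2))⁻¹ := by
    rw [← div_eq_mul_inv, ← div_eq_mul_inv, div_le_div_iff₀ hA hB]
    calc a ^ 3 * √(1 + 2 * b ^ 2) = a ^ 2 * (a * √(1 + 2 * b ^ 2)) := by ring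
      _ ≤ b ^ 2 * (b * √(1 + 2 * a ^ 2)) := by gcongr
      _ = _ := by ring
  have h4 := hφ0 b hb
  calc φ a * (√(1 + 2 * a ^ 2))⁻¹ = φ a / a ^ 3 * (a ^ 3 * (√(1 + 2 * a ^ 2))⁻¹) := by
        field_simp
    _ ≤ φ b / b ^ 3 * (b ^ 3 * (√(1 + 2 * b ^ 2))⁻¹) :=
        mul_le_mul h1 h3 (by positivity) (by positivity)
    _ = _ := by field_simp
end

section
/- For every s > 0 one has |4·(h(s))³·(h'(s))³ − 2·h(s)·h'(s)| < √2, where h'(s) = (1 + 2·(h s)²)^(−1/2). -/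
/-- `|4 (h s)³ (h'(s))³ − 2 h(s) h'(s)| < √2` for all `s > 0`. -/
theorem stmt_13 (h : ℝ → ℝ) (h0 : h 0 = 0)
    (hDeriv : ∀ s : ℝ, HasDerivAt h ((1 + 2 * (h s) ^ 2) ^ (-(1 / 2) : ℝ)) s) :
    ∀ s : ℝ, 0 < s →
      |4 * (h s) ^ 3 * ((1 + 2 * (h s) ^ 2) ^ (-(1 / 2) : ℝ)) ^ 3 -
        2 * h s * ((1 + 2 * (h s) ^ 2) ^ (-(1 / 2) : ℝ))| < Real.sqrt 2 := by
  intro s _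
  have hp : (0 : ℝ) < 1 + 2 * (h s) ^ 2 := by positivity
  have hd : 0 < (1 + 2 * (h s) ^ 2) ^ (-(1 / 2) : ℝ) := Real.rpow_pos_of_pos hp _
  have hq : ((1 + 2 * (h s) ^ 2) ^ (-(1 / 2) : ℝ)) ^ 2 * (1 + 2 * (h s) ^ 2) = 1 := by
    rw [← Real.rpow_natCast, ← Real.rpow_mul hp.le]
    norm_num
    rw [Real.rpow_neg_one]
    exact inv_mul_cancel₀ hp.ne'
  generalize (1 + 2 * (h s) ^ 2) ^ (-(1 / 2) : ℝ) = d at *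
  generalize h s = x at *
  rw [Real.lt_sqrt (abs_nonneg _), sq_abs]
  have e : 4 * x ^ 3 * d ^ 3 - 2 * x * d = -2 * (x * d) * d ^ 2 := by
    linear_combination (2 * x * d) * hq
  have e2 : (-2 * (x * d) * d ^ 2) ^ 2 = 2 * (1 - d ^ 2) * (d ^ 2) ^ 2 := by
    linear_combination (2 * d ^ 4) * hq
  rw [e, e2]
  have h1 : 0 < d ^ 2 := by positivity
  have h2 : d ^ 2 ≤ 1 := by nlinarith [sq_nonneg (x * d)]
  generalize d ^ 2 = y at *
  have h3 : y ^ 2 ≤ 1 := by nlinarith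
  nlinarith [mul_nonneg (sub_nonneg.2 h2) (sub_nonneg.2 h3)]
end

section
/- Let g : ℝ → ℝ be continuous with g(s) ≥ 0 for all s ≥ 0, such that for every ε₀ > 0 one has g(s)·exp(−ε₀·s⁴) → 0 as s → +∞, and define f(s) = g(s)·exp(s⁴); assume moreover that f(s)/s → 0 as s → 0 from the right. Then for every ε > 0 and every real r ≥ 1 there exists a constant C > 0 such that f(s) ≤ ε·s + C·s^(r−1)·exp((1+ε)·s⁴) for all s ≥ 0. -/
/-- Growth estimate `f(s) ≤ ε s + C s^(r−1) exp((1+ε) s⁴)` for the critical exponential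
nonlinearity `f(s) = g(s) exp(s⁴)`. -/
theorem stmt_16 (g : ℝ → ℝ) (hg : Continuous g) (hg0 : ∀ s : ℝ, 0 ≤ s → 0 ≤ g s)
    (hgrow : ∀ ε₀ : ℝ, 0 < ε₀ →
      Filter.Tendsto (fun s : ℝ => g s * Real.exp (-ε₀ * s ^ 4)) Filter.atTop (nhds 0))
    (f : ℝ → ℝ) (hf : f = fun s : ℝ => g s * Real.exp (s ^ 4))
    (hf0 : Filter.Tendsto (fun s : ℝ => f s / s) (nhdsWithin 0 (Set.Ioi 0)) (nhds 0)) :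
    ∀ ε : ℝ, 0 < ε → ∀ r : ℝ, 1 ≤ r → ∃ C : ℝ, 0 < C ∧ ∀ s : ℝ, 0 ≤ s →
      f s ≤ ε * s + C * s ^ (r - 1) * Real.exp ((1 + ε) * s ^ 4) := by
  intro ε hε r hr
  have hfc : Continuous f := by rw [hf]; fun_prop
  have h1 : ∀ᶠ s in nhdsWithin (0:ℝ) (Set.Ioi 0), f s ≤ ε * s := by
    filter_upwards [hf0.eventually (gt_mem_nhds hε), self_mem_nhdsWithin] with s hs hs0
    have hs0' : 0 < s := hs0
    exact ((div_lt_iff₀ hs0').1 hs).le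
  have hz : f 0 ≤ ε * 0 := by
    refine le_of_tendsto_of_tendsto (hfc.continuousAt.tendsto.mono_left nhdsWithin_le_nhds)
      (((continuous_const.mul continuous_id).continuousAt (x := (0:ℝ))).tendsto.mono_left
        nhdsWithin_le_nhds) h1
  obtain ⟨δ, hδ, hδ'⟩ := mem_nhdsGT_iff_exists_Ioo_subset.1 h1
  have hδ0 : 0 < δ := hδ
  obtain ⟨M, hM⟩ := Filter.eventually_atTop.1 ((hgrow ε hε).eventually (gt_mem_nhds one_pos))
  have hc : Continuous (fun s : ℝ => g s * Real.exp (-ε * s ^ 4)) := by fun_prop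
  obtain ⟨B, hB⟩ := (isCompact_Icc (a := (0:ℝ)) (b := M)).bddAbove_image hc.continuousOn
  have hK : ∀ s : ℝ, 0 ≤ s → g s * Real.exp (-ε * s ^ 4) ≤ max B 1 := by
    intro s hs
    rcases le_total M s with h | h
    · exact (hM s h).le.trans (le_max_right _ _)
    · exact (hB ⟨s, ⟨hs, h⟩, rfl⟩).trans (le_max_left _ _)
  have hK0 : 0 < max B 1 := lt_max_of_lt_right one_pos
  have hp : 0 < δ ^ (r - 1) := Real.rpow_pos_of_pos hδ0 _
  refine ⟨max B 1 / δ ^ (r - 1), div_pos hK0 hp, fun s hs => ?_⟩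
  have hsp : 0 ≤ s ^ (r - 1) := Real.rpow_nonneg hs _
  have hC := div_pos hK0 hp
  rcases lt_or_ge s δ with h | h
  · have h2 : f s ≤ ε * s := by
      rcases hs.eq_or_lt with h0 | h0
      · rw [← h0]; exact hz
      · exact hδ' ⟨h0, h⟩
    have : 0 ≤ max B 1 / δ ^ (r - 1) * s ^ (r - 1) * Real.exp ((1 + ε) * s ^ 4) := by positivity
    linarith
  · have h3 : max B 1 ≤ max B 1 / δ ^ (r - 1) * s ^ (r - 1) := by
      rw [div_mul_eq_mul_div, le_div_iff₀ hp]
      exact mul_le_mul_of_nonneg_left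
        (Real.rpow_le_rpow hδ0.le h (by linarith)) hK0.le
    have h4 : f s = g s * Real.exp (-ε * s ^ 4) * Real.exp ((1 + ε) * s ^ 4) := by
      rw [hf, mul_assoc, ← Real.exp_add]
      ring_nf
    have h5 := mul_le_mul_of_nonneg_right ((hK s hs).trans h3)
      (Real.exp_pos ((1 + ε) * s ^ 4)).le
    have h6 : 0 ≤ ε * s := by positivity
    linarith
end

section
/- Let g : ℝ → ℝ be continuous with g(s) ≥ 0 for all s ≥ 0, such that for every ε₀ > 0 one has g(s)·exp(−ε₀·s⁴) → 0 as s → +∞, and define f(s) = g(s)·exp(s⁴); assume moreover that f(s)/s → 0 as s → 0 from the right. Define F(s) = ∫₀ˢ f(t) dt. Then for every ε > 0 and every real r ≥ 1 there exists a constant C > 0 such that F(s) ≤ ε·s² + C·s^r·exp((1+ε)·s⁴) for all s ≥ 0. -/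
/-- Growth estimate `F(s) ≤ ε s² + C s^r exp((1+ε) s⁴)` for the primitive
`F(s) = ∫₀ˢ f(t) dt` of the critical exponential nonlinearity `f(s) = g(s) exp(s⁴)`. -/
theorem stmt_17 (g : ℝ → ℝ) (hg : Continuous g) (hg0 : ∀ s : ℝ, 0 ≤ s → 0 ≤ g s)
    (hgrow : ∀ ε₀ : ℝ, 0 < ε₀ →
      Filter.Tendsto (fun s : ℝ => g s * Real.exp (-ε₀ * s ^ 4)) Filter.atTop (nhds 0))
    (f : ℝ → ℝ) (hf : f = fun s : ℝ => g s * Real.exp (s ^ 4))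
    (hf0 : Filter.Tendsto (fun s : ℝ => f s / s) (nhdsWithin 0 (Set.Ioi 0)) (nhds 0))
    (F : ℝ → ℝ) (hF : F = fun s : ℝ => ∫ t in (0 : ℝ)..s, f t) :
    ∀ ε : ℝ, 0 < ε → ∀ r : ℝ, 1 ≤ r → ∃ C : ℝ, 0 < C ∧ ∀ s : ℝ, 0 ≤ s →
      F s ≤ ε * s ^ 2 + C * s ^ r * Real.exp ((1 + ε) * s ^ 4) := by
  intro ε hε r hr
  have hfnn : ∀ t, 0 ≤ t → 0 ≤ f t := by
    intro t ht
    rw [hf]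
    exact mul_nonneg (hg0 t ht) (Real.exp_pos _).le
  have key : ∀ s K : ℝ, 0 ≤ s → (∀ t, 0 < t → t ≤ s → f t ≤ K) → F s ≤ K * s := by
    intro s K hs hK
    have h := intervalIntegral.norm_integral_le_of_norm_le_const (a := 0) (b := s) (f := f) (C := K)
      (by
        intro t ht
        rw [Set.uIoc_of_le hs] at ht
        rw [Real.norm_of_nonneg (hfnn t ht.1.le)]
        exact hK t ht.1 ht.2)
    rw [sub_zero, abs_of_nonneg hs] at h
    rw [hF]
    exact (Real.le_norm_self _).trans h
  obtain ⟨δ, hδ, hδf⟩ : ∃ δ : ℝ, 0 < δ ∧ ∀ t, 0 < t → t < δ → f t ≤ ε * t := by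
    have h := hf0.eventually (gt_mem_nhds hε)
    obtain ⟨δ, hδ, h⟩ := mem_nhdsGT_iff_exists_Ioo_subset.1 h
    refine ⟨δ, hδ, fun t h0 h1 => ?_⟩
    have h2 : f t / t < ε := h ⟨h0, h1⟩
    exact ((div_lt_iff₀ h0).1 h2).le
  obtain ⟨M, hM, hMg⟩ : ∃ M : ℝ, 0 < M ∧ ∀ t, 0 ≤ t → g t * Real.exp (-ε * t ^ 4) ≤ M := by
    have h := (hgrow ε hε).eventually (gt_mem_nhds one_pos)
    obtain ⟨N, hN⟩ := Filter.eventually_atTop.1 h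
    have hc : Continuous (fun t : ℝ => g t * Real.exp (-ε * t ^ 4)) := by fun_prop
    obtain ⟨B, hB⟩ := (isCompact_Icc (a := (0 : ℝ)) (b := N)).bddAbove_image hc.continuousOn
    refine ⟨max B 1, lt_max_of_lt_right one_pos, fun t ht => ?_⟩
    rcases le_total t N with h1 | h1
    · exact le_max_of_le_left (hB ⟨t, ⟨ht, h1⟩, rfl⟩)
    · exact le_max_of_le_right (hN t h1).le
  have hδr : 0 < δ ^ (r - 1) := Real.rpow_pos_of_pos hδ _
  refine ⟨M / δ ^ (r - 1), by positivity, fun s hs => ?_⟩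
  rcases lt_or_ge s δ with h | h
  · have h1 := key s (ε * s) hs (fun t h0 h1 => (hδf t h0 (h1.trans_lt h)).trans (by gcongr))
    have : 0 ≤ M / δ ^ (r - 1) * s ^ r * Real.exp ((1 + ε) * s ^ 4) := by positivity
    nlinarith
  · have hs0 : 0 < s := hδ.trans_le h
    have h1 := key s (M * Real.exp ((1 + ε) * s ^ 4)) hs (fun t h0 h1 => by
      have e : f t = (g t * Real.exp (-ε * t ^ 4)) * Real.exp ((1 + ε) * t ^ 4) := by
        rw [hf, mul_assoc, ← Real.exp_add]
        ring_nf
      rw [e]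
      have := hMg t h0.le
      gcongr)
    have h2 : δ ^ (r - 1) ≤ s ^ (r - 1) :=
      Real.rpow_le_rpow hδ.le h (by linarith)
    have h3 : s ^ r = s ^ (r - 1) * s := by
      rw [← Real.rpow_add_one hs0.ne']
      ring_nf
    have h4 : s ≤ s ^ r / δ ^ (r - 1) := by
      rw [le_div_iff₀ hδr, h3, mul_comm]
      gcongr
    calc F s ≤ M * Real.exp ((1 + ε) * s ^ 4) * s := h1
      _ ≤ M * Real.exp ((1 + ε) * s ^ 4) * (s ^ r / δ ^ (r - 1)) := by gcongr
      _ = M / δ ^ (r - 1) * s ^ r * Real.exp ((1 + ε) * s ^ 4) := by ring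
      _ ≤ _ := by
        have : 0 ≤ ε * s ^ 2 := by positivity
        linarith
end
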